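/- Let D ≥ 3 and χ ≥ 0. For a bilinear map α : m × m → m which is rotation equivariant and galilean-boost equivariant, define (writing X = (h,p), Y = (h',p'), Z = (h'',p'') and q := h p' − h' p ∈ ℝ^D) the curvature Ω(X,Y)Z := α(X,α(Y,Z)) − α(Y,α(X,Z)) − α((0, 2χ q), Z) − (0, (1+χ²) h'' q); this is the curvature of the invariant connection with Nomizu map α on the (torsional) galilean anti de Sitter spacetime AdSG_χ (brackets [H,B_a] = −P_a, [H,P_a] = (1+χ²)B_a + 2χ P_a). Then there exists no such α with Ω ≡ 0; that is, AdSG_χ admits no flat invariant connection. -/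

import Mathlib

open Matrix

/-- The vector space `m = ℝ × ℝ^D`, with elements written `(h, p)`;
`H = (1, 0)` and `P a = (0, e a)`. -/
abbrev Mspace (D : ℕ) : Type := ℝ × (Fin D → ℝ)

/-- The infinitesimal rotation `ρ_Λ (h, p) = (0, Λ p)` associated to a `D × D` matrix `Λ`. -/
noncomputable def rotMap {D : ℕ} (Λ : Matrix (Fin D) (Fin D) ℝ) :
    Mspace D →ₗ[ℝ] Mspace D :=
  LinearMap.prod 0 (Λ.mulVecLin ∘ₗ LinearMap.snd ℝ ℝ (Fin D → ℝ))

/-- The galilean boost `β_a (h, p) = (0, h • e_a)`. -/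
noncomputable def galBoost {D : ℕ} (a : Fin D) : Mspace D →ₗ[ℝ] Mspace D :=
  LinearMap.prod 0
    (LinearMap.toSpanSingleton ℝ (Fin D → ℝ) (Pi.single a 1) ∘ₗ
      LinearMap.fst ℝ ℝ (Fin D → ℝ))

/-- A bilinear map `α : m × m → m` is equivariant under a linear endomorphism `X` of `m`
if `X (α Y Z) = α (X Y) Z + α Y (X Z)` for all `Y Z ∈ m`. -/
def IsEquivariant {D : ℕ} (X : Mspace D →ₗ[ℝ] Mspace D)
    (α : Mspace D →ₗ[ℝ] Mspace D →ₗ[ℝ] Mspace D) : Prop :=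
  ∀ Y Z : Mspace D, X (α Y Z) = α (X Y) Z + α Y (X Z)

/-- `q = h p' - h' p` for `X = (h, p)`, `Y = (h', p')`. -/
noncomputable def qvec {D : ℕ} (X Y : Mspace D) : Fin D → ℝ :=
  X.1 • Y.2 - Y.1 • X.2

/-- The curvature of the invariant connection with Nomizu map `α` on the (torsional)
galilean anti de Sitter spacetime `AdSG_χ`:
`Ω(X,Y)Z = α(X,α(Y,Z)) - α(Y,α(X,Z)) - α((0, 2χ q), Z) - (0, (1+χ²) h'' q)`. -/
noncomputable def curvatureAdSG {D : ℕ} (χ : ℝ)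
    (α : Mspace D →ₗ[ℝ] Mspace D →ₗ[ℝ] Mspace D) (X Y Z : Mspace D) : Mspace D :=
  α X (α Y Z) - α Y (α X Z) - α ((0, (2 * χ) • qvec X Y) : Mspace D) Z
    - ((0, ((1 + χ ^ 2) * Z.1) • qvec X Y) : Mspace D)

/-- The generator of rotations in the `(i, j)` coordinate plane. -/
noncomputable def planeRot {D : ℕ} (i j : Fin D) : Matrix (Fin D) (Fin D) ℝ :=
  Matrix.single i j 1 - Matrix.single j i 1

lemma planeRot_transpose {D : ℕ} (i j : Fin D) : (planeRot i j)ᵀ = -planeRot i j := by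
  simp [planeRot, Matrix.transpose_single]

lemma planeRot_mulVec {D : ℕ} (i j : Fin D) (v : Fin D → ℝ) :
    planeRot i j *ᵥ v = Pi.single i (v j) - Pi.single j (v i) := by
  ext k
  simp [planeRot, Matrix.sub_mulVec, Matrix.single_mulVec, Function.update_apply, Pi.single_apply]

lemma rotMap_apply {D : ℕ} (Λ : Matrix (Fin D) (Fin D) ℝ) (X : Mspace D) :
    rotMap Λ X = (0, Λ *ᵥ X.2) := rfl

lemma galBoost_apply {D : ℕ} (a : Fin D) (X : Mspace D) :
    galBoost a X = (0, X.1 • Pi.single a 1) := rfl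

lemma exists_ne_ne {D : ℕ} (hD : 3 ≤ D) (a b : Fin D) : ∃ c, c ≠ a ∧ c ≠ b := by
  have h : ({a, b} : Finset (Fin D)).card < Fintype.card (Fin D) := by
    rw [Fintype.card_fin]
    exact lt_of_le_of_lt Finset.card_le_two hD
  obtain ⟨c, hc⟩ := Finset.exists_mem_notMem_of_card_lt_card (t := Finset.univ) h
  exact ⟨c, by simpa using hc⟩

section RotationEquivariant

variable {D : ℕ} {α : Mspace D →ₗ[ℝ] Mspace D →ₗ[ℝ] Mspace D}

/-- Rotation equivariance forces `α(H, H)` to be a multiple of `H`. -/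
lemma snd_apply_H_H_eq_zero (hD : 3 ≤ D)
    (hrot : ∀ Λ : Matrix (Fin D) (Fin D) ℝ, Λᵀ = -Λ → IsEquivariant (rotMap Λ) α) :
    (α (1, 0) (1, 0)).2 = 0 := by
  ext j
  obtain ⟨k, hkj, -⟩ := exists_ne_ne hD j j
  have h := hrot _ (planeRot_transpose k j) (1, 0) (1, 0)
  have hz : rotMap (planeRot k j) ((1, 0) : Mspace D) = 0 := by simp [rotMap_apply]
  rw [hz, map_zero, map_zero, LinearMap.zero_apply, add_zero, rotMap_apply, planeRot_mulVec] at h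
  simpa [hkj] using congrFun (congrArg Prod.snd h) k

/-- Rotation equivariance forces `α(P_a, H)` to be a multiple of `P_a`. -/
lemma apply_P_H_eq (hD : 3 ≤ D)
    (hrot : ∀ Λ : Matrix (Fin D) (Fin D) ℝ, Λᵀ = -Λ → IsEquivariant (rotMap Λ) α) (a : Fin D) :
    α (0, Pi.single a 1) (1, 0) = (α (0, Pi.single a 1) (1, 0)).2 a • (0, Pi.single a 1) := by
  have hz (i j : Fin D) : rotMap (planeRot i j) ((1, 0) : Mspace D) = 0 := by simp [rotMap_apply]
  refine Prod.ext ?_ (funext fun j => ?_)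
  · obtain ⟨b, hba, -⟩ := exists_ne_ne hD a a
    have h := hrot _ (planeRot_transpose a b) (0, Pi.single b 1) (1, 0)
    have hP : rotMap (planeRot a b) ((0, Pi.single b 1) : Mspace D) = (0, Pi.single a 1) := by
      rw [rotMap_apply, planeRot_mulVec]
      simp [hba.symm]
    rw [hz, map_zero, add_zero, hP, rotMap_apply] at h
    simpa using (congrArg Prod.fst h).symm
  · by_cases hja : j = a
    · simp [hja]
    obtain ⟨k, hka, hkj⟩ := exists_ne_ne hD a j
    have h := hrot _ (planeRot_transpose k j) (0, Pi.single a 1) (1, 0)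
    have hP : rotMap (planeRot k j) ((0, Pi.single a 1) : Mspace D) = 0 := by
      rw [rotMap_apply, planeRot_mulVec]
      simp [hka, hja]
    rw [hz, hP, map_zero, map_zero, LinearMap.zero_apply, add_zero, rotMap_apply,
      planeRot_mulVec] at h
    simpa [hkj, hja] using congrFun (congrArg Prod.snd h) k

end RotationEquivariant

/-- For `D ≥ 3` and `χ ≥ 0`, there is no rotation- and galilean-boost-equivariant
bilinear map `α` whose associated invariant connection on `AdSG_χ` is flat: `AdSG_χ`
admits no flat invariant connection. -/
theorem AdSG_no_flat_invariant_connection (D : ℕ) (hD : 3 ≤ D) (χ : ℝ) (hχ : 0 ≤ χ) :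
    ¬ ∃ α : Mspace D →ₗ[ℝ] Mspace D →ₗ[ℝ] Mspace D,
      (∀ Λ : Matrix (Fin D) (Fin D) ℝ, Λᵀ = -Λ → IsEquivariant (rotMap Λ) α) ∧
      (∀ a : Fin D, IsEquivariant (galBoost a) α) ∧
      (∀ X Y Z : Mspace D, curvatureAdSG χ α X Y Z = 0) := by
  rintro ⟨α, hrot, hboost, hflat⟩
  let a : Fin D := ⟨0, by omega⟩
  set P : Mspace D := (0, Pi.single a 1) with hPdef
  set H : Mspace D := (1, 0) with hHdef
  obtain ⟨ν, hν⟩ : ∃ ν : ℝ, α P H = ν • P := ⟨_, apply_P_H_eq hD hrot a⟩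
  obtain ⟨l, hl⟩ : ∃ l : ℝ, α H H = l • H :=
    ⟨(α H H).1, Prod.ext (by simp [hHdef]) (by
      rw [show (α H H).2 = 0 from snd_apply_H_H_eq_zero hD hrot]; simp [hHdef])⟩
  have hboostH : galBoost a H = P := by simp [galBoost_apply, hHdef, hPdef]
  have hHP : α H P = (l - ν) • P := by
    have h := hboost a H H
    rw [hl, map_smul, hboostH, hν] at h
    rw [sub_smul, h, add_sub_cancel_left]
  have hq (c : ℝ) : ((0, c • qvec H P) : Mspace D) = c • P := by
    simp [qvec, hHdef, hPdef]
  have h := hflat H P H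
  rw [curvatureAdSG, hq, hq, hν, hl, map_smul, map_smul, map_smul, LinearMap.smul_apply, hν,
    hHP] at h
  have h' := congrFun (congrArg Prod.snd h) a
  simp [hHdef, hPdef] at h'
  nlinarith [sq_nonneg (ν + χ)]
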